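/- Fix d ≥ 2 and let R_1 = A_{α,β} for some α ∈ S^{d−1} and β ∈ [0,1]. Let X_1, …, X_n be fixed distinct design points in S^{d−1} and let Y_i = μ⁽¹⁾·1{X_i ∈ R_1} + μ⁽⁰⁾·1{X_i ∉ R_1} + ε_i, where ε_1,…,ε_n are i.i.d. N(0, σ²) and θ := |μ⁽¹⁾ − μ⁽⁰⁾|. Suppose L_n(R_1, ∅) = τ > 0, and let R̂ be any maximizer of |T_A(Y)| over A ∈ 𝒮. Then there exist universal constants C_1, C_2 > 0 such that for all n large enough, with probability at least 1 − C_1 · n^{−(d+1)}, one has L_n(R̂, R_1) ≤ C_2 · σ² · d · log(n) / (θ² · τ · n). -/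

import Mathlib

open MeasureTheory ProbabilityTheory
open scoped symmDiff ENNReal NNReal

attribute [local instance] Classical.propDecidable

/-- Number of design points falling in `A`, i.e. `|A|_D`. -/
noncomputable def cnt {M : Type*} {n : ℕ} (X : Fin n → M) (A : Set M) : ℕ :=
  (Finset.univ.filter fun i => X i ∈ A).card

/-- Sum of the entries of `Z` over indices whose design point lies in `A`. -/
noncomputable def sumIn {M : Type*} {n : ℕ} (X : Fin n → M) (A : Set M) (Z : Fin n → ℝ) : ℝ :=
  ∑ i ∈ Finset.univ.filter (fun i => X i ∈ A), Z i

/-- The CUSUM statistic `T_A(Z)`, with the convention that it is `0` when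
`|A|_D = 0` or `|A^c|_D = 0`. -/
noncomputable def cusum {M : Type*} {n : ℕ} (X : Fin n → M) (A : Set M) (Z : Fin n → ℝ) : ℝ :=
  if cnt X A = 0 ∨ cnt X Aᶜ = 0 then 0
  else Real.sqrt ((cnt X A : ℝ) * (cnt X Aᶜ : ℝ) / (n : ℝ)) *
    (sumIn X A Z / (cnt X A : ℝ) - sumIn X Aᶜ Z / (cnt X Aᶜ : ℝ))

/-- The in-sample loss `L_n(A, B) = (1/n) * min(|A △ B|_D, |A △ B^c|_D)`. -/
noncomputable def lossN {M : Type*} {n : ℕ} (X : Fin n → M) (A B : Set M) : ℝ :=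
  (1 / (n : ℝ)) * min ((cnt X (A ∆ B) : ℝ)) ((cnt X (A ∆ Bᶜ) : ℝ))

open scoped RealInnerProductSpace

/-- The unit sphere `S^{d-1}` in `ℝ^d`. -/
abbrev Sph (d : ℕ) : Set (EuclideanSpace ℝ (Fin d)) :=
  Metric.sphere (0 : EuclideanSpace ℝ (Fin d)) 1

/-- The spherical disc `A_{α,β} = {x ∈ S^{d-1} : ⟨x, α⟩ ≥ β}`. -/
def disc {d : ℕ} (α : Sph d) (β : ℝ) : Set (Sph d) :=
  {x : Sph d | β ≤ ⟪(x : EuclideanSpace ℝ (Fin d)), (α : EuclideanSpace ℝ (Fin d))⟫}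

/-- The collection `𝒮` of discs `A_{α,β}` with `α ∈ S^{d-1}` and `β ∈ [0,1]`. -/
def discs (d : ℕ) : Set (Set (Sph d)) :=
  {A | ∃ α : Sph d, ∃ β ∈ Set.Icc (0 : ℝ) 1, A = disc α β}


lemma tail_bound {n : ℕ} (σ K : ℝ) (hσ : 0 < σ) (hK : 0 ≤ K) (w : Fin n → ℝ) :
    (Measure.pi fun _ : Fin n => gaussianReal 0 ⟨σ ^ 2, sq_nonneg σ⟩)
      {ε : Fin n → ℝ | K * Real.sqrt (∑ i, w i ^ 2) < ∑ i, w i * ε i}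
      ≤ ENNReal.ofReal (Real.exp (-K ^ 2 / (2 * σ ^ 2))) := by
  set v : ℝ≥0 := ⟨σ ^ 2, sq_nonneg σ⟩ with hv
  set P := (Measure.pi fun _ : Fin n => gaussianReal 0 v) with hP
  have hind : iIndepFun (fun (i : Fin n) (ε : Fin n → ℝ) => w i * ε i) P :=
    iIndepFun_pi (X := fun i x => w i * x) (fun i => (measurable_const_mul (w i)).aemeasurable)
  have hsub0 : HasSubgaussianMGF (id : ℝ → ℝ) v (gaussianReal 0 v) :=
    ⟨fun t => integrable_exp_mul_gaussianReal t, fun t => by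
      rw [mgf_id_gaussianReal]; simp⟩
  have hmap : ∀ i : Fin n, P.map (fun ε : Fin n → ℝ => ε i) = gaussianReal 0 v := fun i => by
    exact (measurePreserving_eval (fun _ : Fin n => gaussianReal 0 v) i).map_eq
  have hsub : ∀ i : Fin n, HasSubgaussianMGF (fun ε : Fin n → ℝ => w i * ε i)
      (⟨w i ^ 2, sq_nonneg _⟩ * v) P := fun i => by
    apply HasSubgaussianMGF.const_mul
    have := HasSubgaussianMGF.of_map (X := id) (Y := fun ε : Fin n → ℝ => ε i) (c := v) (μ := P)
      (measurable_pi_apply i).aemeasurable (by rw [hmap i]; exact hsub0)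
    exact this
  by_cases hw : ∑ i, w i ^ 2 = 0
  · have hw0 : ∀ i, w i = 0 := fun i => by
      have := (Finset.sum_eq_zero_iff_of_nonneg (fun i _ => sq_nonneg (w i))).1 hw i (Finset.mem_univ i)
      exact pow_eq_zero_iff (two_ne_zero) |>.1 this
    simp [hw0]
  have hpos : 0 < ∑ i, w i ^ 2 := lt_of_le_of_ne (Finset.sum_nonneg fun i _ => sq_nonneg _) (Ne.symm hw)
  have h := HasSubgaussianMGF.measure_sum_ge_le_of_iIndepFun hind (s := Finset.univ)
    (fun i _ => hsub i) (ε := K * Real.sqrt (∑ i, w i ^ 2)) (by positivity)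
  have e1 : ((∑ i, (⟨w i ^ 2, sq_nonneg _⟩ * v : ℝ≥0) : ℝ≥0) : ℝ) = (∑ i, w i ^ 2) * σ ^ 2 := by
    rw [Finset.sum_mul]; push_cast; rfl
  have e2 : -(K * Real.sqrt (∑ i, w i ^ 2)) ^ 2 / (2 * ((∑ i, w i ^ 2) * σ ^ 2))
      = -K ^ 2 / (2 * σ ^ 2) := by
    rw [mul_pow, Real.sq_sqrt hpos.le]; field_simp
  rw [e1, e2] at h
  calc P {ε : Fin n → ℝ | K * Real.sqrt (∑ i, w i ^ 2) < ∑ i, w i * ε i} ≤ P {ε | K * Real.sqrt (∑ i, w i ^ 2) ≤ ∑ i, w i * ε i} :=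
        measure_mono (Set.setOf_subset_setOf.2 fun ε hε => le_of_lt hε)
    _ = ENNReal.ofReal (P.real {ε | K * Real.sqrt (∑ i, w i ^ 2) ≤ ∑ i, w i * ε i}) :=
        (ofReal_measureReal).symm
    _ ≤ _ := ENNReal.ofReal_le_ofReal h

/-- index trace -/
noncomputable def tr {M : Type*} {n : ℕ} (X : Fin n → M) (A : Set M) : Finset (Fin n) :=
  Finset.univ.filter fun i => X i ∈ A

noncomputable def fam {d n : ℕ} (X : Fin n → Sph d) : Finset (Finset (Fin n)) :=
  Finset.univ.filter fun S => ∃ A ∈ discs d, tr X A = S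

lemma shat {d n : ℕ} (X : Fin n → Sph d) (s : Finset (Fin n)) (hs : (fam X).Shatters s) :
    s.card ≤ d + 1 := by
  by_contra hc
  push Not at hc
  let f : s → EuclideanSpace ℝ (Fin d) := fun i => (X i : EuclideanSpace ℝ (Fin d))
  have hna : ¬ AffineIndependent ℝ f := fun h => by
    have h1 := h.card_le_finrank_succ
    have h2 := Submodule.finrank_le (vectorSpan ℝ (Set.range f))
    simp at h1 h2
    omega
  obtain ⟨I, p, hp1, hp2⟩ := Convex.radon_partition hna
  obtain ⟨u, hu, hsu⟩ := hs (t := s.filter fun i => ∃ h : i ∈ s, (⟨i, h⟩ : s) ∈ I)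
    (Finset.filter_subset _ _)
  simp only [fam, Finset.mem_filter, Finset.mem_univ, true_and] at hu
  obtain ⟨A, ⟨α, β, hβ, rfl⟩, rfl⟩ := hu
  have hmem : ∀ i : s, i ∈ I ↔ X i ∈ disc α β := fun i => by
    have := congrArg (fun t => (i : Fin n) ∈ t) hsu
    simp [tr] at this
    exact this.symm
  have hlin : IsLinearMap ℝ (fun x : EuclideanSpace ℝ (Fin d) => ⟪x, (α : EuclideanSpace ℝ (Fin d))⟫) :=
    ⟨fun x y => inner_add_left _ _ _, fun c x => by simp [real_inner_smul_left]⟩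
  have c1 : convexHull ℝ (f '' I) ⊆ {x | β ≤ ⟪x, (α : EuclideanSpace ℝ (Fin d))⟫} := by
    apply convexHull_min _ (convex_halfSpace_ge hlin β)
    rintro _ ⟨i, hi, rfl⟩
    exact (hmem i).1 hi
  have c2 : convexHull ℝ (f '' Iᶜ) ⊆ {x | ⟪x, (α : EuclideanSpace ℝ (Fin d))⟫ < β} := by
    apply convexHull_min _ (convex_halfSpace_lt hlin β)
    rintro _ ⟨i, hi, rfl⟩
    have := mt (hmem i).2 hi
    simpa [disc] using this
  have h1 := c1 hp1
  have h2 := c2 hp2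
  simp only [Set.mem_ofPred_eq] at h1 h2
  linarith

lemma fam_card {d n : ℕ} (hn : d + 2 ≤ n) (X : Fin n → Sph d) : (fam X).card ≤ n ^ (d + 2) := by
  have hv : (fam X).vcDim ≤ d + 1 := Finset.sup_le fun s hs => shat X s (Finset.mem_shatterer.1 hs)
  calc (fam X).card ≤ (fam X).shatterer.card := Finset.card_le_card_shatterer _
    _ ≤ ∑ k ∈ Finset.Iic (fam X).vcDim, (Fintype.card (Fin n)).choose k :=
      Finset.card_shatterer_le_sum_vcDim
    _ ≤ ∑ k ∈ Finset.Iic (d + 1), n.choose k := by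
      rw [Fintype.card_fin]
      exact Finset.sum_le_sum_of_subset (Finset.Iic_subset_Iic.2 hv)
    _ ≤ ∑ k ∈ Finset.Iic (d + 1), n ^ (d + 1) := by
      refine Finset.sum_le_sum fun k hk => (Nat.choose_le_pow n k).trans ?_
      exact Nat.pow_le_pow_right (by omega) (Finset.mem_Iic.1 hk)
    _ = (d + 2) * n ^ (d + 1) := by simp
    _ ≤ n * n ^ (d + 1) := Nat.mul_le_mul_right _ hn
    _ = _ := by ring

lemma real_key (p q r s ρ : ℝ) (hp : 0 ≤ p) (hq : 0 ≤ q) (hr : 0 ≤ r) (hs : 0 ≤ s)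
    (ha : 0 < p + q) (hb : 0 < r + s) (hc : 0 < p + r) (he : 0 < q + s)
    (h : ρ ^ 2 * ((p + q) * (r + s) * (p + r) * (q + s)) = (p * s - q * r) ^ 2)
    (h1 : -1 ≤ ρ) (h2 : ρ ≤ 1) :
    min (q + r) (p + s) ≤ 2 * (p + q + r + s) * (1 - ρ) := by
  have hN : 0 < p + q + r + s := by linarith
  have g : (p * q * (r + s) + r * s * (p + q)) * (p + q + r + s)
      = (p + q) * (r + s) * ((p + r) * (q + s) * (1 - ρ ^ 2)) := by
    linear_combination h
  have hρ : 0 ≤ 1 - ρ ^ 2 := by nlinarith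
  have hρ2 : 1 - ρ ^ 2 ≤ 2 * (1 - ρ) := by nlinarith
  have m1 : (p + q) * min p q ≤ 2 * (p * q) := by
    rcases le_total p q with h | h <;> simp only [h, min_eq_left, min_eq_right] <;> nlinarith
  have m2 : (r + s) * min r s ≤ 2 * (r * s) := by
    rcases le_total r s with h | h <;> simp only [h, min_eq_left, min_eq_right] <;> nlinarith
  have key : (min p q + min r s) * (p + q + r + s) ≤ 2 * ((p + r) * (q + s)) * (1 - ρ ^ 2) := by
    have hab : 0 < (p + q) * (r + s) := mul_pos ha hb
    refine le_of_mul_le_mul_left ?_ hab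
    have : (p + q) * (r + s) * (min p q + min r s) ≤ 2 * (p * q * (r + s) + r * s * (p + q)) := by
      nlinarith [mul_le_mul_of_nonneg_left m1 hb.le, mul_le_mul_of_nonneg_left m2 ha.le]
    nlinarith [mul_le_mul_of_nonneg_right this hN.le]
  have hce : 4 * ((p + r) * (q + s)) ≤ (p + q + r + s) ^ 2 := by
    nlinarith [sq_nonneg (p + r - (q + s))]
  have hmin : 2 * min (q + r) (p + s) ≤ p + q + r + s := by
    linarith [min_le_left (q + r) (p + s), min_le_right (q + r) (p + s)]
  have good : min (q + r) (p + s) ≤ min p q + min r s →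
      min (q + r) (p + s) ≤ 2 * (p + q + r + s) * (1 - ρ) := by
    intro hm
    have t1 : (min p q + min r s) * (p + q + r + s) ≤
        ((p + q + r + s) * (1 - ρ)) * (p + q + r + s) := by
      nlinarith [mul_le_mul_of_nonneg_right hce hρ, mul_le_mul_of_nonneg_left hρ2 (sq_nonneg (p + q + r + s))]
    have t2 := le_of_mul_le_mul_right t1 hN
    nlinarith [mul_nonneg hN.le (sub_nonneg.2 h2)]
  have bad : 1 / 2 ≤ 1 - ρ ^ 2 → min (q + r) (p + s) ≤ 2 * (p + q + r + s) * (1 - ρ) := by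
    intro hm
    have h5 : (p + q + r + s) * (1 / 4) ≤ (p + q + r + s) * (1 - ρ) :=
      mul_le_mul_of_nonneg_left (by linarith) hN.le
    linarith
  rcases le_total p q with hpq | hpq <;> rcases le_total r s with hrs | hrs <;>
    simp only [hpq, hrs, min_eq_left, min_eq_right] at key good
  · apply bad
    have : p + q + r + s ≤ 2 * (q + s) * (1 - ρ ^ 2) :=
      le_of_mul_le_mul_left (by linarith) hc
    have h5 : (q + s) * (1 - ρ ^ 2) ≤ (p + q + r + s) * (1 - ρ ^ 2) :=
      mul_le_mul_of_nonneg_right (by linarith) hρ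
    exact le_of_mul_le_mul_left (by linarith) hN
  · exact good (min_le_right _ _)
  · exact good (min_le_left _ _)
  · apply bad
    have : p + q + r + s ≤ 2 * (p + r) * (1 - ρ ^ 2) :=
      le_of_mul_le_mul_left (by linarith) he
    have h5 : (p + r) * (1 - ρ ^ 2) ≤ (p + q + r + s) * (1 - ρ ^ 2) :=
      mul_le_mul_of_nonneg_right (by linarith) hρ
    exact le_of_mul_le_mul_left (by linarith) hN

noncomputable def vec {n : ℕ} (S : Finset (Fin n)) (i : Fin n) : ℝ :=
  if S.card = 0 ∨ Sᶜ.card = 0 then 0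
  else Real.sqrt ((S.card : ℝ) * (Sᶜ.card : ℝ) / (n : ℝ)) *
    (if i ∈ S then 1 / (S.card : ℝ) else - (1 / (Sᶜ.card : ℝ)))

lemma sum4 {n : ℕ} (S R : Finset (Fin n)) (x y z w : ℝ) :
    ∑ i, (if i ∈ S then (if i ∈ R then x else y) else (if i ∈ R then z else w))
      = (S ∩ R).card * x + (S ∩ Rᶜ).card * y + (Sᶜ ∩ R).card * z + (Sᶜ ∩ Rᶜ).card * w := by
  have h : ∀ i, (if i ∈ S then (if i ∈ R then x else y) else (if i ∈ R then z else w))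
      = (if i ∈ S ∩ R then x else 0) + (if i ∈ S ∩ Rᶜ then y else 0)
        + (if i ∈ Sᶜ ∩ R then z else 0) + (if i ∈ Sᶜ ∩ Rᶜ then w else 0) := by
    intro i
    by_cases h1 : i ∈ S <;> by_cases h2 : i ∈ R <;> simp [h1, h2]
  simp_rw [h, Finset.sum_add_distrib, Finset.sum_ite_mem, Finset.univ_inter, Finset.sum_const,
    nsmul_eq_mul]

lemma card_split {n : ℕ} (S R : Finset (Fin n)) :
    (S.card : ℝ) = (S ∩ R).card + (S ∩ Rᶜ).card := by
  rw [← Finset.sdiff_eq_inter_compl]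
  exact_mod_cast (Finset.card_inter_add_card_sdiff S R).symm

lemma card_add_compl' {n : ℕ} (S : Finset (Fin n)) : (S.card : ℝ) + (Sᶜ.card : ℝ) = n := by
  have := Finset.card_add_card_compl S
  rw [Fintype.card_fin] at this
  exact_mod_cast this

lemma vec_sq {n : ℕ} (S : Finset (Fin n)) (h1 : S.card ≠ 0) (h2 : Sᶜ.card ≠ 0) :
    ∑ i, vec S i ^ 2 = 1 := by
  have hN := card_add_compl' S
  have p1 : (0 : ℝ) < S.card := by positivity
  have p2 : (0 : ℝ) < Sᶜ.card := by positivity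
  have h0 : ∀ i, vec S i ^ 2 = if i ∈ S then ((S.card : ℝ) * Sᶜ.card / n) * (1 / S.card) ^ 2
      else ((S.card : ℝ) * Sᶜ.card / n) * (1 / Sᶜ.card) ^ 2 := by
    intro i
    simp only [vec, h1, h2, or_self, if_false]
    rw [mul_pow, Real.sq_sqrt (by positivity)]
    split_ifs <;> ring
  have h3 := sum4 S S (((S.card : ℝ) * Sᶜ.card / n) * (1 / S.card) ^ 2)
    (((S.card : ℝ) * Sᶜ.card / n) * (1 / S.card) ^ 2)
    (((S.card : ℝ) * Sᶜ.card / n) * (1 / Sᶜ.card) ^ 2)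
    (((S.card : ℝ) * Sᶜ.card / n) * (1 / Sᶜ.card) ^ 2)
  simp only [ite_self] at h3
  simp_rw [h0]
  rw [h3]
  simp only [Finset.inter_self, Finset.inter_compl, Finset.inter_comm Sᶜ S,
    Finset.inter_compl, Finset.card_empty]
  rw [← hN]
  push_cast
  field_simp
  ring

lemma vec_sum {n : ℕ} (S : Finset (Fin n)) : ∑ i, vec S i = 0 := by
  by_cases hd : S.card = 0 ∨ Sᶜ.card = 0
  · simp only [vec, if_pos hd, Finset.sum_const_zero]
  push Not at hd
  obtain ⟨h1, h2⟩ := hd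
  have p1 : (0 : ℝ) < S.card := by positivity
  have p2 : (0 : ℝ) < Sᶜ.card := by positivity
  simp only [vec, h1, h2, or_self, if_false]
  rw [← Finset.mul_sum]
  have h3 := sum4 S S (1 / (S.card : ℝ)) (1 / (S.card : ℝ)) (-(1 / (Sᶜ.card : ℝ))) (-(1 / (Sᶜ.card : ℝ)))
  simp only [ite_self] at h3
  rw [h3]
  simp only [Finset.inter_self, Finset.inter_compl, Finset.inter_comm Sᶜ S,
    Finset.inter_compl, Finset.card_empty]
  push_cast
  field_simp
  ring_nf

lemma vec_inner {n : ℕ} (S R : Finset (Fin n)) (h1 : S.card ≠ 0) (h2 : Sᶜ.card ≠ 0)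
    (h3 : R.card ≠ 0) (h4 : Rᶜ.card ≠ 0) :
    (∑ i, vec S i * vec R i) ^ 2 * ((S.card : ℝ) * Sᶜ.card * R.card * Rᶜ.card)
      = (((S ∩ R).card : ℝ) * (Sᶜ ∩ Rᶜ).card - (S ∩ Rᶜ).card * (Sᶜ ∩ R).card) ^ 2 := by
  have hN := card_add_compl' S
  have p1 : (0 : ℝ) < S.card := by positivity
  have p2 : (0 : ℝ) < Sᶜ.card := by positivity
  have p3 : (0 : ℝ) < R.card := by positivity
  have p4 : (0 : ℝ) < Rᶜ.card := by positivity
  have h0 : ∀ i, vec S i * vec R i =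
      (Real.sqrt ((S.card : ℝ) * Sᶜ.card / n) * Real.sqrt ((R.card : ℝ) * Rᶜ.card / n)) *
      (if i ∈ S then (if i ∈ R then 1 / (S.card : ℝ) * (1 / R.card) else
        - (1 / (S.card : ℝ) * (1 / Rᶜ.card)))
       else (if i ∈ R then -(1 / (Sᶜ.card : ℝ) * (1 / R.card)) else
         (1 / (Sᶜ.card : ℝ) * (1 / Rᶜ.card)))) := by
    intro i
    simp only [vec, h1, h2, h3, h4, or_self, if_false]
    split_ifs <;> ring
  simp_rw [h0]
  rw [← Finset.mul_sum, sum4, mul_pow, mul_pow, Real.sq_sqrt (by positivity),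
    Real.sq_sqrt (by positivity)]
  have e1 := card_split S R
  have e2 := card_split Sᶜ R
  have e3 := card_split R S
  have e4 := card_split Rᶜ S
  rw [Finset.inter_comm R S, Finset.inter_comm R Sᶜ] at e3
  rw [Finset.inter_comm Rᶜ S, Finset.inter_comm Rᶜ Sᶜ] at e4
  rw [← hN]
  generalize (S.card : ℝ) = a at *
  generalize (Sᶜ.card : ℝ) = b at *
  generalize (R.card : ℝ) = c at *
  generalize (Rᶜ.card : ℝ) = e at *
  generalize ((S ∩ R).card : ℝ) = p at *
  generalize ((S ∩ Rᶜ).card : ℝ) = q at *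
  generalize ((Sᶜ ∩ R).card : ℝ) = r at *
  generalize ((Sᶜ ∩ Rᶜ).card : ℝ) = s at *
  have hab : 0 < a + b := by positivity
  have : p * (1 / a * (1 / c)) + q * -(1 / a * (1 / e)) + r * -(1 / b * (1 / c)) + s * (1 / b * (1 / e))
      = (a + b) * (p * s - q * r) / (a * b * c * e) := by
    field_simp
    subst e1 e2 e3 e4
    ring
  rw [this]
  field_simp

lemma vec_key {n : ℕ} (S R : Finset (Fin n)) (h3 : R.card ≠ 0) (h4 : Rᶜ.card ≠ 0) (t : ℝ)
    (ht : t = 1 ∨ t = -1) :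
    0 ≤ 1 - t * ∑ i, vec S i * vec R i ∧
    (∑ i, (t * vec S i - vec R i) ^ 2) ≤ 2 * (1 - t * ∑ i, vec S i * vec R i) ∧
    min (((S ∩ Rᶜ).card : ℝ) + (Sᶜ ∩ R).card) ((S ∩ R).card + (Sᶜ ∩ Rᶜ).card) ≤
      2 * n * (1 - t * ∑ i, vec S i * vec R i) := by
  have hR := vec_sq R h3 h4
  have ht2 : t ^ 2 = 1 := by rcases ht with rfl | rfl <;> norm_num
  have hexp : ∀ t : ℝ, ∑ i, (t * vec S i - vec R i) ^ 2
      = t ^ 2 * ∑ i, vec S i ^ 2 + ∑ i, vec R i ^ 2 - 2 * (t * ∑ i, vec S i * vec R i) := by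
    intro t
    rw [Finset.mul_sum, Finset.mul_sum, Finset.mul_sum, ← Finset.sum_add_distrib,
      ← Finset.sum_sub_distrib]
    exact Finset.sum_congr rfl fun i _ => by ring
  have e1 := card_split S R
  have e2 := card_split Sᶜ R
  have e3 := card_split R S
  have e4 := card_split Rᶜ S
  have hN := card_add_compl' S
  rw [Finset.inter_comm R S, Finset.inter_comm R Sᶜ] at e3
  rw [Finset.inter_comm Rᶜ S, Finset.inter_comm Rᶜ Sᶜ] at e4
  by_cases hd : S.card = 0 ∨ Sᶜ.card = 0
  · have h0 : ∀ i, vec S i = 0 := fun i => by simp only [vec, if_pos hd]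
    simp only [h0, zero_mul, mul_zero, Finset.sum_const_zero, zero_sub, neg_sq, hR, sub_zero]
    refine ⟨by norm_num, by norm_num, ?_⟩
    rcases min_le_iff.1 (le_refl (min (((S ∩ Rᶜ).card : ℝ) + (Sᶜ ∩ R).card)
      ((S ∩ R).card + (Sᶜ ∩ Rᶜ).card))) with h | h
    all_goals
      refine (min_le_left _ _).trans ?_
      have a1 : (0 : ℝ) ≤ (S ∩ R).card := by positivity
      have a2 : (0 : ℝ) ≤ (Sᶜ ∩ Rᶜ).card := by positivity
      have a3 : (0 : ℝ) ≤ (S ∩ Rᶜ).card := by positivity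
      have a4 : (0 : ℝ) ≤ (Sᶜ ∩ R).card := by positivity
      linarith
  push Not at hd
  obtain ⟨h1, h2⟩ := hd
  have hS := vec_sq S h1 h2
  have hq := vec_inner S R h1 h2 h3 h4
  set ρ := ∑ i, vec S i * vec R i
  have n1 : 0 ≤ ∑ i, (1 * vec S i - vec R i) ^ 2 := Finset.sum_nonneg fun i _ => sq_nonneg _
  have n2 : 0 ≤ ∑ i, (-1 * vec S i - vec R i) ^ 2 := Finset.sum_nonneg fun i _ => sq_nonneg _
  rw [hexp, hS, hR] at n1 n2
  have p1 : (0 : ℝ) < S.card := by positivity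
  have p2 : (0 : ℝ) < Sᶜ.card := by positivity
  have p3 : (0 : ℝ) < R.card := by positivity
  have p4 : (0 : ℝ) < Rᶜ.card := by positivity
  refine ⟨by rcases ht with rfl | rfl <;> linarith, by rw [hexp, hS, hR, ht2]; linarith, ?_⟩
  rw [← hN]
  rw [e1, e2, e3, e4] at hq
  rw [e1] at p1 ⊢
  rw [e2] at p2 ⊢
  rw [e3] at p3
  rw [e4] at p4
  rw [← add_assoc]
  apply real_key _ _ _ _ _ (by positivity) (by positivity) (by positivity) (by positivity) p1 p2 p3 p4
  · rw [mul_pow, ht2, one_mul]; exact hq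
  · rcases ht with rfl | rfl <;> linarith
  · rcases ht with rfl | rfl <;> linarith

lemma tr_compl {M : Type*} {n : ℕ} (X : Fin n → M) (A : Set M) : tr X Aᶜ = (tr X A)ᶜ := by
  ext i; simp [tr]

lemma cnt_eq {M : Type*} {n : ℕ} (X : Fin n → M) (A : Set M) : cnt X A = (tr X A).card := rfl

lemma cusum_eq {M : Type*} {n : ℕ} (X : Fin n → M) (A : Set M) (Z : Fin n → ℝ) :
    cusum X A Z = ∑ i, vec (tr X A) i * Z i := by
  by_cases hd : (tr X A).card = 0 ∨ (tr X A)ᶜ.card = 0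
  · have h0 : ∀ i, vec (tr X A) i = 0 := fun i => by simp only [vec, if_pos hd]
    simp only [cusum, cnt_eq, tr_compl, if_pos hd, h0, zero_mul, Finset.sum_const_zero]
  · simp only [cusum, cnt_eq, tr_compl, if_neg hd, vec]
    have hS : sumIn X A Z = ∑ i, if i ∈ tr X A then Z i else 0 := by
      rw [Finset.sum_ite_mem, Finset.univ_inter]; rfl
    have hS' : sumIn X Aᶜ Z = ∑ i, if i ∈ tr X A then 0 else Z i := by
      have : sumIn X Aᶜ Z = ∑ i ∈ tr X Aᶜ, Z i := rfl
      rw [this, tr_compl, ← Finset.univ_inter (tr X A)ᶜ, ← Finset.sum_ite_mem]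
      refine Finset.sum_congr rfl fun i _ => ?_
      by_cases h : i ∈ tr X A <;> simp [h]
    rw [hS, hS', Finset.sum_div, Finset.sum_div, ← Finset.sum_sub_distrib, Finset.mul_sum]
    refine Finset.sum_congr rfl fun i _ => ?_
    split_ifs <;> ring

lemma card_union' {n : ℕ} (S R : Finset (Fin n)) (T : Finset (Fin n))
    (h : ∀ i, i ∈ T ↔ (i ∈ S ∧ i ∉ R) ∨ (i ∉ S ∧ i ∈ R)) :
    (T.card : ℝ) = (S ∩ Rᶜ).card + (Sᶜ ∩ R).card := by
  have : T = (S ∩ Rᶜ) ∪ (Sᶜ ∩ R) := by ext i; rw [h]; simp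
  rw [this, Finset.card_union_of_disjoint]
  · push_cast; rfl
  · rw [Finset.disjoint_left]; intro i; simp; tauto

lemma loss_eq {M : Type*} {n : ℕ} (X : Fin n → M) (A B : Set M) :
    lossN X A B = (1 / (n : ℝ)) * min (((tr X A ∩ (tr X B)ᶜ).card : ℝ) + ((tr X A)ᶜ ∩ tr X B).card)
      ((tr X A ∩ tr X B).card + ((tr X A)ᶜ ∩ (tr X B)ᶜ).card) := by
  unfold lossN
  rw [cnt_eq, cnt_eq, card_union' (tr X A) (tr X B) (tr X (A ∆ B)),
    card_union' (tr X A) (tr X B)ᶜ (tr X (A ∆ Bᶜ)), compl_compl]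
  · intro i; simp [tr, Set.mem_symmDiff]; tauto
  · intro i; simp [tr, Set.mem_symmDiff]; tauto

/-- mean decomposition -/
lemma mean_eq {n : ℕ} (R : Finset (Fin n)) (h1 : R.card ≠ 0) (h2 : Rᶜ.card ≠ 0) (m1 m0 : ℝ)
    (i : Fin n) :
    (if i ∈ R then m1 else m0) = (m0 + (m1 - m0) * R.card / n) +
      (m1 - m0) * Real.sqrt ((R.card : ℝ) * (Rᶜ.card : ℝ) / (n : ℝ)) * vec R i := by
  have hN := card_add_compl' R
  have p1 : (0 : ℝ) < R.card := by positivity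
  have p2 : (0 : ℝ) < Rᶜ.card := by positivity
  have hn : (0 : ℝ) < n := by linarith
  have hsq : Real.sqrt ((R.card : ℝ) * (Rᶜ.card : ℝ) / (n : ℝ)) *
      Real.sqrt ((R.card : ℝ) * (Rᶜ.card : ℝ) / (n : ℝ)) = (R.card : ℝ) * (Rᶜ.card : ℝ) / (n : ℝ) :=
    Real.mul_self_sqrt (by positivity)
  simp only [vec, h1, h2, or_self, if_false]
  rw [mul_assoc (m1 - m0), ← mul_assoc (Real.sqrt _) (Real.sqrt _), hsq, ← hN]
  split_ifs
  · field_simp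
    ring
  · field_simp
    ring

lemma det_bound {n : ℕ} (S R : Finset (Fin n)) (h3 : R.card ≠ 0) (h4 : Rᶜ.card ≠ 0)
    (m1 m0 u K : ℝ) (hu : u * (m1 - m0) = |m1 - m0|) (hu1 : u = 1 ∨ u = -1) (hK : 0 ≤ K)
    (ε : Fin n → ℝ)
    (hmax : |∑ i, vec R i * ((if i ∈ R then m1 else m0) + ε i)| ≤
      |∑ i, vec S i * ((if i ∈ R then m1 else m0) + ε i)|)
    (hgood : ∀ t : ℝ, t = 1 ∨ t = -1 →
      ∑ i, (u * (t * vec S i - vec R i)) * ε i ≤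
        K * Real.sqrt (∑ i, (u * (t * vec S i - vec R i)) ^ 2)) :
    min (((S ∩ Rᶜ).card : ℝ) + (Sᶜ ∩ R).card) ((S ∩ R).card + (Sᶜ ∩ Rᶜ).card) *
      (|m1 - m0| ^ 2 * ((R.card : ℝ) * (Rᶜ.card : ℝ) / (n : ℝ))) ≤ 4 * n * K ^ 2 := by
  set g := Real.sqrt ((R.card : ℝ) * (Rᶜ.card : ℝ) / (n : ℝ)) with hg
  have hg0 : 0 ≤ g := Real.sqrt_nonneg _
  have hg2 : g ^ 2 = (R.card : ℝ) * (Rᶜ.card : ℝ) / (n : ℝ) := Real.sq_sqrt (by positivity)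
  have hu2 : u ^ 2 = 1 := by rcases hu1 with rfl | rfl <;> norm_num
  have hT : ∀ Q : Finset (Fin n), ∑ i, vec Q i * ((if i ∈ R then m1 else m0) + ε i)
      = (m1 - m0) * g * (∑ i, vec Q i * vec R i) + ∑ i, vec Q i * ε i := by
    intro Q
    have e : ∀ i, vec Q i * ((if i ∈ R then m1 else m0) + ε i)
        = (m0 + (m1 - m0) * R.card / n) * vec Q i + (m1 - m0) * g * (vec Q i * vec R i)
          + vec Q i * ε i := by
      intro i
      rw [mean_eq R h3 h4 m1 m0 i]
      ring
    simp_rw [e, Finset.sum_add_distrib, ← Finset.mul_sum]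
    rw [vec_sum]
    ring
  have hRR : ∑ i, vec R i * vec R i = 1 := by
    rw [← vec_sq R h3 h4]; exact Finset.sum_congr rfl fun i _ => by ring
  rw [hT, hT, hRR, mul_one] at hmax
  set ρ := ∑ i, vec S i * vec R i with hρ
  set eR := ∑ i, vec R i * ε i with heR
  set eS := ∑ i, vec S i * ε i with heS
  have hlow : |m1 - m0| * g + u * eR ≤ |(m1 - m0) * g + eR| := by
    rw [← hu]
    rcases hu1 with rfl | rfl
    · refine le_trans (le_of_eq ?_) (le_abs_self _); ring
    · refine le_trans (le_of_eq ?_) (neg_le_abs _); ring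
  obtain ⟨t, ht, hup⟩ : ∃ t : ℝ, (t = 1 ∨ t = -1) ∧
      |(m1 - m0) * g * ρ + eS| = t * u * ((m1 - m0) * g * ρ + eS) := by
    rcases abs_choice ((m1 - m0) * g * ρ + eS) with h | h
    · refine ⟨u, hu1, ?_⟩
      rw [h, ← pow_two, hu2, one_mul]
    · refine ⟨-u, by rcases hu1 with rfl | rfl <;> simp, ?_⟩
      rw [h, neg_mul, ← pow_two, hu2]; ring
  obtain ⟨q0, q1, q2⟩ := vec_key S R h3 h4 t ht
  have hG := hgood t ht
  have w1 : ∑ i, (u * (t * vec S i - vec R i)) * ε i = u * t * eS - u * eR := by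
    rw [heS, heR, Finset.mul_sum, Finset.mul_sum, ← Finset.sum_sub_distrib]
    exact Finset.sum_congr rfl fun i _ => by ring
  have w2 : ∑ i, (u * (t * vec S i - vec R i)) ^ 2 = ∑ i, (t * vec S i - vec R i) ^ 2 :=
    Finset.sum_congr rfl fun i _ => by rw [mul_pow, hu2, one_mul]
  rw [w1, w2] at hG
  rw [← hρ] at q0 q1 q2
  set q := 1 - t * ρ with hq
  set W := ∑ i, (t * vec S i - vec R i) ^ 2
  have hmain : |m1 - m0| * g * q ≤ K * Real.sqrt (2 * q) := by
    have h5 : K * Real.sqrt W ≤ K * Real.sqrt (2 * q) :=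
      mul_le_mul_of_nonneg_left (Real.sqrt_le_sqrt q1) hK
    have h6 : t * u * ((m1 - m0) * g * ρ + eS) = |m1 - m0| * g * (t * ρ) + u * t * eS := by
      rw [← hu]; ring
    rw [hup, h6] at hmax
    have : |m1 - m0| * g * q = |m1 - m0| * g - |m1 - m0| * g * (t * ρ) := by rw [hq]; ring
    linarith
  have hsq : (|m1 - m0| * g * q) ^ 2 ≤ K ^ 2 * (2 * q) := by
    calc _ ≤ (K * Real.sqrt (2 * q)) ^ 2 := pow_le_pow_left₀ (by positivity) hmain 2
      _ = _ := by rw [mul_pow, Real.sq_sqrt (by positivity)]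
  have hfin : |m1 - m0| ^ 2 * g ^ 2 * q ≤ 2 * K ^ 2 := by
    rcases q0.eq_or_lt with h | h
    · rw [← h]; rw [mul_zero]; positivity
    · refine le_of_mul_le_mul_right ?_ h
      linarith
  rw [← hg2]
  calc _ ≤ 2 * n * q * (|m1 - m0| ^ 2 * g ^ 2) := mul_le_mul_of_nonneg_right q2 (by positivity)
    _ = 2 * n * (|m1 - m0| ^ 2 * g ^ 2 * q) := by ring
    _ ≤ 2 * n * (2 * K ^ 2) := mul_le_mul_of_nonneg_left hfin (by positivity)
    _ = _ := by ring

/-- Corollary (single spherical-cap change region, estimation of the region): with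
probability at least `1 − C₁ n^{−(d+1)}`, any maximiser of the absolute CUSUM statistic over
the class of spherical discs estimates the true disc with loss at most
`C₂ σ² d log n / (θ² τ n)`, for all `n` large enough. -/
theorem statement5 :
    ∃ C₁ C₂ : ℝ, 0 < C₁ ∧ 0 < C₂ ∧
      ∀ d : ℕ, 2 ≤ d →
        ∀ σ θ τ : ℝ, 0 < σ → 0 < θ → 0 < τ →
          ∃ N : ℕ, ∀ n : ℕ, N ≤ n →
            ∀ X : Fin n → Sph d, Function.Injective X →
              ∀ (α : Sph d), ∀ β ∈ Set.Icc (0 : ℝ) 1,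
                ∀ μ₁ μ₀ : ℝ, θ = |μ₁ - μ₀| → lossN X (disc α β) ∅ = τ →
                  ∀ Rhat : (Fin n → ℝ) → Set (Sph d),
                    (∀ y : Fin n → ℝ, Rhat y ∈ discs d ∧
                      ∀ A ∈ discs d, |cusum X A y| ≤ |cusum X (Rhat y) y|) →
                    ENNReal.ofReal (1 - C₁ / (n : ℝ) ^ (d + 1)) ≤
                      (Measure.pi fun _ : Fin n => gaussianReal 0 ⟨σ ^ 2, sq_nonneg σ⟩)
                        {ε : Fin n → ℝ |
                          lossN X (Rhat fun i => (if X i ∈ disc α β then μ₁ else μ₀) + ε i)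
                              (disc α β) ≤
                            C₂ * σ ^ 2 * (d : ℝ) * Real.log n / (θ ^ 2 * τ * (n : ℝ))} := by
  refine ⟨2, 64, by norm_num, by norm_num, ?_⟩
  intro d hd σ θ τ hσ hθ hτ
  refine ⟨d + 2, fun n hn X _ α β _ μ₁ μ₀ hθe hτe Rhat hRhat => ?_⟩
  set R := tr X (disc α β) with hR
  set P := (Measure.pi fun _ : Fin n => gaussianReal 0 ⟨σ ^ 2, sq_nonneg σ⟩) with hP
  have hprob : ∀ v : ℝ≥0, IsProbabilityMeasure (Measure.pi fun _ : Fin n => gaussianReal 0 v) :=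
    fun v => inferInstance
  have : IsProbabilityMeasure P := hprob _
  have hn0 : (0 : ℝ) < n := by exact_mod_cast (by omega : 0 < n)
  have hn1 : (1 : ℝ) ≤ n := by exact_mod_cast (by omega : 1 ≤ n)
  have hlog : 0 ≤ Real.log n := Real.log_nonneg hn1
  have hNR := card_add_compl' R
  have hτ2 : min (R.card : ℝ) (Rᶜ.card : ℝ) = τ * n := by
    have h := hτe
    have he : tr X (∅ : Set (Sph d)) = ∅ := by ext i; simp [tr]
    rw [loss_eq, he, ← hR] at h
    simp at h
    rw [← h]; field_simp
  have hr : τ * n ≤ R.card := hτ2 ▸ min_le_left _ _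
  have hs : τ * n ≤ Rᶜ.card := hτ2 ▸ min_le_right _ _
  have hτn : 0 < τ * n := by positivity
  have h3 : R.card ≠ 0 := by
    have : (0 : ℝ) < R.card := by linarith
    exact_mod_cast this.ne'
  have h4 : Rᶜ.card ≠ 0 := by
    have : (0 : ℝ) < Rᶜ.card := by linarith
    exact_mod_cast this.ne'
  have hrs : τ * n / 2 ≤ (R.card : ℝ) * (Rᶜ.card : ℝ) / (n : ℝ) := by
    rw [le_div_iff₀ hn0]
    rcases le_total (R.card : ℝ) (Rᶜ.card : ℝ) with h | h
    · have : (n : ℝ) / 2 ≤ Rᶜ.card := by linarith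
      calc τ * n / 2 * n = τ * n * (n / 2) := by ring
        _ ≤ R.card * Rᶜ.card := mul_le_mul hr this (by positivity) (by positivity)
    · have : (n : ℝ) / 2 ≤ R.card := by linarith
      calc τ * n / 2 * n = (n / 2) * (τ * n) := by ring
        _ ≤ R.card * Rᶜ.card := mul_le_mul this hs (by positivity) (by positivity)
  obtain ⟨u, hu1, hu⟩ : ∃ u : ℝ, (u = 1 ∨ u = -1) ∧ u * (μ₁ - μ₀) = |μ₁ - μ₀| := by
    rcases abs_choice (μ₁ - μ₀) with h | h
    · exact ⟨1, Or.inl rfl, by rw [h, one_mul]⟩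
    · exact ⟨-1, Or.inr rfl, by rw [h, neg_one_mul]⟩
  set K := σ * Real.sqrt (8 * d * Real.log n) with hKdef
  have hK : 0 ≤ K := by positivity
  have hK2 : K ^ 2 = σ ^ 2 * (8 * d * Real.log n) := by
    rw [hKdef, mul_pow, Real.sq_sqrt (by positivity)]
  let bad : Finset (Fin n) → ℝ → Set (Fin n → ℝ) := fun S t =>
    {ε | K * Real.sqrt (∑ i, (u * (t * vec S i - vec R i)) ^ 2) <
      ∑ i, (u * (t * vec S i - vec R i)) * ε i}
  let Bad : Set (Fin n → ℝ) := ⋃ S ∈ fam X, (bad S 1 ∪ bad S (-1))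
  have hexp : Real.exp (-K ^ 2 / (2 * σ ^ 2)) = ((n : ℝ) ^ (4 * d))⁻¹ := by
    have : -K ^ 2 / (2 * σ ^ 2) = - (((4 * d : ℕ) : ℝ) * Real.log n) := by
      rw [hK2]; push_cast; field_simp; ring
    rw [this, Real.exp_neg, Real.exp_nat_mul, Real.exp_log hn0]
  have hBad : P Bad ≤ ENNReal.ofReal (2 / (n : ℝ) ^ (d + 1)) := by
    calc P Bad ≤ ∑ S ∈ fam X, P (bad S 1 ∪ bad S (-1)) := measure_biUnion_finset_le _ _
      _ ≤ ∑ S ∈ fam X, ENNReal.ofReal (2 * ((n : ℝ) ^ (4 * d))⁻¹) := by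
        refine Finset.sum_le_sum fun S _ => (measure_union_le _ _).trans ?_
        rw [two_mul, ENNReal.ofReal_add (by positivity) (by positivity), ← hexp]
        exact add_le_add (tail_bound σ K hσ hK _) (tail_bound σ K hσ hK _)
      _ = ENNReal.ofReal ((fam X).card * (2 * ((n : ℝ) ^ (4 * d))⁻¹)) := by
        rw [Finset.sum_const, nsmul_eq_mul, ENNReal.ofReal_mul (p := ((fam X).card : ℝ)) (by positivity),
          ENNReal.ofReal_natCast]
      _ ≤ _ := by
        apply ENNReal.ofReal_le_ofReal
        have hc : ((fam X).card : ℝ) ≤ (n : ℝ) ^ (d + 2) := by exact_mod_cast fam_card hn X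
        calc ((fam X).card : ℝ) * (2 * ((n : ℝ) ^ (4 * d))⁻¹)
            ≤ (n : ℝ) ^ (d + 2) * (2 * ((n : ℝ) ^ (4 * d))⁻¹) :=
              mul_le_mul_of_nonneg_right hc (by positivity)
          _ = 2 * ((n : ℝ) ^ (d + 2) / (n : ℝ) ^ (4 * d)) := by rw [div_eq_mul_inv]; ring
          _ ≤ 2 * (1 / (n : ℝ) ^ (d + 1)) := by
              refine mul_le_mul_of_nonneg_left ?_ (by norm_num)
              rw [div_le_div_iff₀ (by positivity) (by positivity), one_mul, ← pow_add]
              exact pow_le_pow_right₀ hn1 (by omega)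
          _ = _ := by ring
  set G : Set (Fin n → ℝ) := {ε : Fin n → ℝ |
    lossN X (Rhat fun i => (if X i ∈ disc α β then μ₁ else μ₀) + ε i) (disc α β) ≤
      64 * σ ^ 2 * (d : ℝ) * Real.log n / (θ ^ 2 * τ * (n : ℝ))} with hG
  have hcover : (Set.univ : Set (Fin n → ℝ)) ⊆ G ∪ Bad := by
    intro ε _
    by_cases hb : ε ∈ Bad
    · exact Or.inr hb
    left
    have hmemR : ∀ i, (X i ∈ disc α β) ↔ i ∈ R := fun i => by simp [hR, tr]
    obtain ⟨hA, hmax⟩ := hRhat (fun i => (if X i ∈ disc α β then μ₁ else μ₀) + ε i)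
    have hmax' := hmax (disc α β) ⟨α, β, ‹_›, rfl⟩
    change lossN X (Rhat fun i => (if X i ∈ disc α β then μ₁ else μ₀) + ε i) (disc α β) ≤ _
    generalize (Rhat fun i => (if X i ∈ disc α β then μ₁ else μ₀) + ε i) = A at hA hmax' ⊢
    rw [cusum_eq, cusum_eq, ← hR] at hmax'
    have hSf : tr X A ∈ fam X := by
      simp only [fam, Finset.mem_filter, Finset.mem_univ, true_and]
      exact ⟨A, hA, rfl⟩
    have hconv : ∀ i, ((if X i ∈ disc α β then μ₁ else μ₀) : ℝ) = if i ∈ R then μ₁ else μ₀ := by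
      intro i
      by_cases h : i ∈ R
      · rw [if_pos h, if_pos ((hmemR i).2 h)]
      · rw [if_neg h, if_neg (mt (hmemR i).1 h)]
    simp_rw [hconv] at hmax'
    have hdet := det_bound (tr X A) R h3 h4 μ₁ μ₀ u K hu hu1 hK ε hmax' (by
      intro t ht
      by_contra hc
      push Not at hc
      apply hb
      refine Set.mem_biUnion hSf ?_
      rcases ht with rfl | rfl
      · exact Or.inl hc
      · exact Or.inr hc)
    rw [loss_eq, ← hR]
    rw [← hθe, hK2] at hdet
    generalize min (((tr X A ∩ Rᶜ).card : ℝ) + ((tr X A)ᶜ ∩ R).card)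
      ((tr X A ∩ R).card + ((tr X A)ᶜ ∩ Rᶜ).card) = m at hdet ⊢
    by_cases hm : m ≤ 0
    · refine le_trans (mul_nonpos_of_nonneg_of_nonpos (by positivity) hm) (by positivity)
    push Not at hm
    have h7 : m * (θ ^ 2 * (τ * n / 2)) ≤ 4 * n * (σ ^ 2 * (8 * d * Real.log n)) :=
      le_trans (by gcongr) hdet
    rw [le_div_iff₀ (by positivity)]
    have h8 : 1 / (n : ℝ) * m * (θ ^ 2 * τ * n) = (2 / n) * (m * (θ ^ 2 * (τ * n / 2))) := by
      field_simp
    rw [h8]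
    calc _ ≤ (2 / (n : ℝ)) * (4 * n * (σ ^ 2 * (8 * d * Real.log n))) :=
          mul_le_mul_of_nonneg_left h7 (by positivity)
      _ = _ := by field_simp; ring
  have hone : 1 ≤ P G + ENNReal.ofReal (2 / (n : ℝ) ^ (d + 1)) := by
    calc (1 : ℝ≥0∞) = P Set.univ := measure_univ.symm
      _ ≤ P (G ∪ Bad) := measure_mono hcover
      _ ≤ P G + P Bad := measure_union_le _ _
      _ ≤ _ := by gcongr
  rw [ENNReal.ofReal_sub _ (by positivity), ENNReal.ofReal_one]
  exact tsub_le_iff_right.2 hone
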